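/- arXiv:2207.04469 — 2 statements merged into one kernel-verified Lean document; each statement's English description precedes it below -/
import Mathlib

section
/- For every n ≥ 1, the following identity holds in F, where every complete homogeneous symmetric polynomial h_m below is evaluated at the 2n quantities (u X_1, …, u X_n, v X_1^{−1}, …, v X_n^{−1}): (1/2) · det_{1 ≤ i, j ≤ n}( (u²X_i² + u w X_i)^{j−1} + (v²X_i^{−2} + v w X_i^{−1})^{j−1} ) / ∏_{1 ≤ i < j ≤ n} (X_j − X_i)(u − v X_i^{−1} X_j^{−1}) = det_{1 ≤ i, j ≤ n−1}( Σ_{k=j}^{2j} binom(j, k−j) w^{2j−k} ( h_{k−i} − u^{n−i} v^{n−i} h_{k+i−2n} ) ), where for n = 1 the empty (n−1) × (n−1) determinant is set equal to 1. -/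
noncomputable section

/-- Complete homogeneous symmetric polynomial of degree `m` evaluated at the list `l`. -/
def hpow {R : Type*} [CommSemiring R] : ℕ → List R → R
  | 0, _ => 1
  | _ + 1, [] => 0
  | m + 1, x :: xs => hpow (m + 1) xs + x * hpow m (x :: xs)
  termination_by m l => m + l.length

/-- `h_m` with integer degree: zero for negative degrees. -/
def hz {R : Type*} [CommSemiring R] (m : ℤ) (l : List R) : R :=
  if m < 0 then 0 else hpow m.toNat l

/-- Elementary symmetric polynomial of degree `m` evaluated at the list `l`;
zero for `m` larger than the length of `l`. -/
def epow {R : Type*} [CommSemiring R] : ℕ → List R → R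
  | 0, _ => 1
  | _ + 1, [] => 0
  | m + 1, x :: xs => epow (m + 1) xs + x * epow m xs

/-- `e_m` with integer degree: zero for negative degrees. -/
def ez {R : Type*} [CommSemiring R] (m : ℤ) (l : List R) : R :=
  if m < 0 then 0 else epow m.toNat l

/-- The field `F = ℚ(u, v, w, X_1, …, X_n)` of rational functions. -/
abbrev Fld (n : ℕ) : Type := FractionRing (MvPolynomial (Fin n ⊕ Fin 3) ℚ)

/-- The indeterminate `u`. -/
def uu (n : ℕ) : Fld n :=
  algebraMap (MvPolynomial (Fin n ⊕ Fin 3) ℚ) (Fld n) (MvPolynomial.X (Sum.inr 0))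

/-- The indeterminate `v`. -/
def vv (n : ℕ) : Fld n :=
  algebraMap (MvPolynomial (Fin n ⊕ Fin 3) ℚ) (Fld n) (MvPolynomial.X (Sum.inr 1))

/-- The indeterminate `w`. -/
def wP (n : ℕ) : Fld n :=
  algebraMap (MvPolynomial (Fin n ⊕ Fin 3) ℚ) (Fld n) (MvPolynomial.X (Sum.inr 2))

/-- The indeterminate `X_i` (here `i : Fin n` corresponds to `X_{i+1}`). -/
def XP {n : ℕ} (i : Fin n) : Fld n :=
  algebraMap (MvPolynomial (Fin n ⊕ Fin 3) ℚ) (Fld n) (MvPolynomial.X (Sum.inl i))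

/-- The `2n` quantities `(u X_1, …, u X_n, v X_1^{−1}, …, v X_n^{−1})`. -/
def bigArgs (n : ℕ) : List (Fld n) :=
  ((List.finRange n).map fun i => uu n * XP i) ++ ((List.finRange n).map fun i => vv n * (XP i)⁻¹)

/-- `h_m(u X_1, …, u X_n, v X_1^{−1}, …, v X_n^{−1})`. -/
def Hn (n : ℕ) (m : ℤ) : Fld n := hz m (bigArgs n)

section JacobiTrudi

open Finset Polynomial

/-- The generating function of the complete homogeneous symmetric polynomials. -/
theorem mk_hpow_mul_prod {R : Type*} [CommRing R] (l : List R) :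
    PowerSeries.mk (fun m => hpow m l) *
      (l.map fun x => 1 - PowerSeries.C x * PowerSeries.X).prod = 1 := by
  induction l with
  | nil =>
    ext m
    cases m with
    | zero => simp [hpow]
    | succ m => simp [hpow, PowerSeries.coeff_one]
  | cons x l ih =>
    have key : PowerSeries.mk (fun m => hpow m (x :: l)) *
        (1 - PowerSeries.C x * PowerSeries.X) = PowerSeries.mk (fun m => hpow m l) := by
      rw [mul_sub, mul_one, mul_left_comm]
      ext m
      cases m with
      | zero => simp [hpow]
      | succ m =>
        rw [map_sub, PowerSeries.coeff_C_mul, PowerSeries.coeff_succ_mul_X]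
        simp [hpow]
    rw [List.map_cons, List.prod_cons, ← mul_assoc, key, ih]

/-- The power sums `a ^ k + b ^ k`, with the value in degree `0` replaced by `1`. -/
def modPowerSum {R : Type*} [CommRing R] (a b : R) (k : ℕ) : R :=
  if k = 0 then 1 else a ^ k + b ^ k

theorem mk_modPowerSum_mul {R : Type*} [CommRing R] (a b : R) :
    PowerSeries.mk (modPowerSum a b) *
      ((1 - C (a + b) * X + C (a * b) * X ^ 2 : R[X]) : PowerSeries R) =
      ((1 - C (a * b) * X ^ 2 : R[X]) : PowerSeries R) := by
  obtain ⟨t, ht⟩ : ∃ t, t = a + b := ⟨_, rfl⟩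
  obtain ⟨q, hq⟩ : ∃ q, q = a * b := ⟨_, rfl⟩
  rw [← ht, ← hq]
  simp only [Polynomial.coe_add, Polynomial.coe_sub, Polynomial.coe_one, Polynomial.coe_mul,
    Polynomial.coe_C, Polynomial.coe_X, Polynomial.coe_pow]
  rw [mul_add, mul_sub, mul_one, mul_left_comm, mul_left_comm _ (PowerSeries.C q)]
  ext m
  simp only [map_add, map_sub, PowerSeries.coeff_C_mul, PowerSeries.coeff_mul_X_pow',
    PowerSeries.coeff_one, PowerSeries.coeff_mk]
  match m with
  | 0 => simp [modPowerSum]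
  | 1 =>
    rw [← zero_add 1, PowerSeries.coeff_succ_mul_X]
    simp [modPowerSum, ht]
  | 2 =>
    rw [← one_add_one_eq_two, PowerSeries.coeff_succ_mul_X]
    simp [modPowerSum, ht, hq]
    ring
  | m + 3 =>
    rw [show m + 3 = m + 2 + 1 from rfl, PowerSeries.coeff_succ_mul_X]
    simp [modPowerSum, ht, hq]
    ring

/-- `A` satisfies `A(X) = c * q ^ m * X ^ (2 * m) * A(1 / (q X))` up to clearing denominators. -/
def IsSelfReciprocal {R : Type*} [CommRing R] (q c : R) (m : ℕ) (A : R[X]) : Prop :=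
  A.natDegree ≤ 2 * m ∧ (reflect (2 * m) A).comp (C q * X) = C (c * q ^ m) * A

theorem IsSelfReciprocal.mul {R : Type*} [CommRing R] {q c d : R} {m k : ℕ} {A B : R[X]}
    (hA : IsSelfReciprocal q c m A) (hB : IsSelfReciprocal q d k B) :
    IsSelfReciprocal q (c * d) (m + k) (A * B) := by
  refine ⟨natDegree_mul_le.trans (by have := hA.1; have := hB.1; omega), ?_⟩
  rw [mul_add, reflect_mul _ _ hA.1 hB.1, mul_comp, hA.2, hB.2, pow_add]
  simp only [map_mul]
  ring

theorem IsSelfReciprocal.prod {R ι : Type*} [CommRing R] {q : R} (s : Finset ι) (A : ι → R[X])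
    (h : ∀ i ∈ s, IsSelfReciprocal q 1 1 (A i)) :
    IsSelfReciprocal q 1 s.card (∏ i ∈ s, A i) := by
  classical
  induction s using Finset.induction_on with
  | empty => exact ⟨by simp, by rw [prod_empty, ← C_1, reflect_C]; simp⟩
  | insert i s hi ih =>
    rw [prod_insert hi, card_insert_of_notMem hi, add_comm]
    simpa using (h i (mem_insert_self i s)).mul
      (ih fun j hj => h j (mem_insert_of_mem hj))

theorem isSelfReciprocal_quadratic {R : Type*} [CommRing R] (q t : R) :
    IsSelfReciprocal q 1 1 (1 - C t * X + C q * X ^ 2) := by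
  refine ⟨by compute_degree, ?_⟩
  have h : reflect 2 (1 - C t * X + C q * X ^ 2 : R[X]) = X ^ 2 - C t * X + C q := by
    rw [reflect_add, reflect_sub, reflect_C_mul_X_pow, ← pow_one X, reflect_C_mul_X_pow, ← C_1,
      reflect_C, revAt_le one_le_two, revAt_le le_rfl]
    simp
  rw [mul_one, h]
  simp
  ring

theorem isSelfReciprocal_one_sub {R : Type*} [CommRing R] (q : R) :
    IsSelfReciprocal q (-1) 1 (1 - C q * X ^ 2) := by
  refine ⟨by compute_degree, ?_⟩
  have h : reflect 2 (1 - C q * X ^ 2 : R[X]) = X ^ 2 - C q := by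
    rw [reflect_sub, reflect_C_mul_X_pow, ← C_1, reflect_C, revAt_le le_rfl]
    simp
  rw [mul_one, h]
  simp
  ring

theorem IsSelfReciprocal.coeff_eq {K : Type*} [Field K] {q c : K} (hq : q ≠ 0) {m : ℕ} {A : K[X]}
    (h : IsSelfReciprocal q c m A) {r : ℕ} (hr : r ≤ m) :
    A.coeff (2 * m - r) = c * q ^ (m - r) * A.coeff r := by
  have h2 := congrArg (fun p => p.coeff r) h.2
  simp only [comp_C_mul_X_coeff, coeff_C_mul, coeff_reflect, revAt_le (by omega : r ≤ 2 * m)] at h2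
  have h3 : q ^ m = q ^ r * q ^ (m - r) := by rw [← pow_add]; congr 1; omega
  rw [h3] at h2
  apply mul_right_cancel₀ (pow_ne_zero r hq)
  rw [h2]
  ring

/-- The entries of the Jacobi–Trudi type matrix before taking linear combinations of columns. -/
def symplecticEntry {K : Type*} [CommRing K] (q : K) (n : ℕ) (l : List K) (r k : ℕ) : K :=
  hz ((k : ℤ) - r) l - q ^ (n - r) * hz ((k : ℤ) + r - 2 * n) l

theorem coeff_mul_mk_hpow {R : Type*} [CommRing R] (l : List R) (A : R[X]) {N : ℕ}
    (hA : A.natDegree ≤ N) (k : ℕ) :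
    PowerSeries.coeff k ((A : PowerSeries R) * PowerSeries.mk fun m => hpow m l) =
      ∑ r ∈ range (N + 1), A.coeff r * hz ((k : ℤ) - r) l := by
  rw [PowerSeries.coeff_mul,
    Nat.sum_antidiagonal_eq_sum_range_succ
      (fun r s => PowerSeries.coeff r (A : PowerSeries R) *
        PowerSeries.coeff s (PowerSeries.mk fun m => hpow m l))]
  have h1 : ∀ r ∈ range (k + 1), PowerSeries.coeff r (A : PowerSeries R) *
      PowerSeries.coeff (k - r) (PowerSeries.mk fun m => hpow m l) =
      A.coeff r * hz ((k : ℤ) - r) l := by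
    intro r hr
    have hr' : r ≤ k := by simpa [Nat.lt_succ_iff] using hr
    rw [Polynomial.coeff_coe, PowerSeries.coeff_mk, hz, if_neg (by omega)]
    congr 2
    omega
  rw [sum_congr rfl h1]
  have h2 : ∑ r ∈ range (k + 1), A.coeff r * hz ((k : ℤ) - r) l =
      ∑ r ∈ range (k + N + 1), A.coeff r * hz ((k : ℤ) - r) l := by
    refine sum_subset (range_subset_range.2 (by omega)) fun r _ hr => ?_
    rw [mem_range, not_lt] at hr
    rw [hz, if_pos (by omega), mul_zero]
  have h3 : ∑ r ∈ range (N + 1), A.coeff r * hz ((k : ℤ) - r) l =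
      ∑ r ∈ range (k + N + 1), A.coeff r * hz ((k : ℤ) - r) l := by
    refine sum_subset (range_subset_range.2 (by omega)) fun r _ hr => ?_
    rw [mem_range, not_lt] at hr
    rw [coeff_eq_zero_of_natDegree_lt (by omega), zero_mul]
  rw [h2, h3]

theorem sum_range_eq_sum_symplecticEntry {K : Type*} [Field K] [NeZero (2 : K)] {q : K}
    (hq : q ≠ 0) {n : ℕ} {A : K[X]} (h : IsSelfReciprocal q (-1) n A) (l : List K) (k : ℕ) :
    ∑ r ∈ range (2 * n + 1), A.coeff r * hz ((k : ℤ) - r) l =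
      ∑ r ∈ range n, A.coeff r * symplecticEntry q n l r k := by
  have hmid : A.coeff n = 0 := by
    have h1 := h.coeff_eq hq le_rfl
    rw [show 2 * n - n = n by omega, Nat.sub_self, pow_zero] at h1
    have h2 : (2 : K) * A.coeff n = 0 := by linear_combination h1
    exact (mul_eq_zero.1 h2).resolve_left (NeZero.ne 2)
  have htop : ∑ r ∈ range n, A.coeff (n + 1 + r) * hz ((k : ℤ) - (n + 1 + r : ℕ)) l =
      ∑ r ∈ range n, -(q ^ (n - r) * A.coeff r * hz ((k : ℤ) + r - 2 * n) l) := by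
    rw [← sum_range_reflect]
    refine sum_congr rfl fun r hr => ?_
    rw [mem_range] at hr
    rw [show n + 1 + (n - 1 - r) = 2 * n - r by omega, h.coeff_eq hq hr.le,
      show (k : ℤ) - (2 * n - r : ℕ) = (k : ℤ) + r - 2 * n by omega]
    ring
  rw [show 2 * n + 1 = n + 1 + n by omega, sum_range_add, sum_range_succ, hmid, zero_mul, add_zero,
    htop, ← sum_add_distrib]
  refine sum_congr rfl fun r _ => ?_
  rw [symplecticEntry]
  ring

/-- The quantities `a_1, …, a_n, b_1, …, b_n`. -/
def pairList {R : Type*} {n : ℕ} (a b : Fin n → R) : List R :=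
  ((List.finRange n).map a) ++ ((List.finRange n).map b)

theorem prod_pairList {R : Type*} [CommRing R] {n : ℕ} (a b : Fin n → R) {q : R}
    (hab : ∀ i, a i * b i = q) :
    ((pairList a b).map fun x => 1 - PowerSeries.C x * PowerSeries.X).prod =
      ((∏ i, (1 - C (a i + b i) * X + C q * X ^ 2) : R[X]) : PowerSeries R) := by
  have h : ∀ f : Fin n → PowerSeries R, ((List.finRange n).map f).prod = ∏ i, f i := fun f => by
    rw [← List.ofFn_eq_map, List.prod_ofFn]
  rw [pairList, List.map_append, List.prod_append, List.map_map, List.map_map, h, h,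
    ← prod_mul_distrib, ← Polynomial.coeToPowerSeries.ringHom_apply, map_prod]
  refine prod_congr rfl fun i _ => ?_
  simp only [Function.comp, Polynomial.coeToPowerSeries.ringHom_apply, Polynomial.coe_add,
    Polynomial.coe_sub, Polynomial.coe_one, Polynomial.coe_mul,
    Polynomial.coe_C, Polynomial.coe_X, Polynomial.coe_pow, ← hab i, map_mul, map_add]
  ring

theorem exists_modPowerSum_eq_sum {K : Type*} [Field K] [NeZero (2 : K)] {n : ℕ}
    (a b : Fin n → K) {q : K} (hq : q ≠ 0) (hab : ∀ i, a i * b i = q) :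
    ∃ D : Matrix (Fin n) (Fin n) K, ∀ i k,
      modPowerSum (a i) (b i) k =
        ∑ r : Fin n, D i r * symplecticEntry q n (pairList a b) r k := by
  let Q : Fin n → K[X] := fun i => 1 - C (a i + b i) * X + C q * X ^ 2
  let A : Fin n → K[X] := fun i => (1 - C q * X ^ 2) * ∏ j ∈ univ.erase i, Q j
  have hA : ∀ i, IsSelfReciprocal q (-1) n (A i) := by
    intro i
    have h := (isSelfReciprocal_one_sub q).mul
      (IsSelfReciprocal.prod (univ.erase i) Q fun j _ => isSelfReciprocal_quadratic q _)
    rwa [mul_one, card_erase_of_mem (mem_univ i), card_univ, Fintype.card_fin,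
      Nat.add_sub_cancel' i.pos] at h
  refine ⟨fun i r => (A i).coeff r, fun i k => ?_⟩
  rw [Fin.sum_univ_eq_sum_range
    (fun r => (A i).coeff r * symplecticEntry q n (pairList a b) r k),
    ← sum_range_eq_sum_symplecticEntry hq (hA i), ← coeff_mul_mk_hpow _ _ (hA i).1,
    ← PowerSeries.coeff_mk k (modPowerSum (a i) (b i))]
  congr 1
  have hQ : (Q i : PowerSeries K) ≠ 0 := by
    intro h
    have h0 := congrArg (PowerSeries.coeff 0) h
    simp [Q] at h0
  apply mul_right_cancel₀ hQ
  have h1 := mk_modPowerSum_mul (a i) (b i)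
  rw [hab] at h1
  have h2 := mk_hpow_mul_prod (pairList a b)
  rw [prod_pairList a b hab, ← prod_erase_mul _ _ (mem_univ i), Polynomial.coe_mul] at h2
  rw [h1]
  simp only [A, Q, Polynomial.coe_mul] at h2 ⊢
  linear_combination -((1 - C q * X ^ 2 : K[X]) : PowerSeries K) * h2

theorem exists_monic_eval_eq_modPowerSum {R : Type*} [CommRing R] [Nontrivial R] (q : R) (k : ℕ) :
    ∃ P : R[X], P.Monic ∧ P.natDegree = k ∧
      ∀ a b : R, a * b = q → P.eval (a + b) = modPowerSum a b k := by
  induction k using Nat.strong_induction_on with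
  | _ k ih =>
    match k, ih with
    | 0, _ => exact ⟨1, monic_one, natDegree_one, fun a b _ => by simp [modPowerSum]⟩
    | 1, _ => exact ⟨X, monic_X, natDegree_X, fun a b _ => by simp [modPowerSum]⟩
    | 2, _ =>
      refine ⟨X ^ 2 - C (2 * q), monic_X_pow_sub_C _ two_ne_zero, natDegree_X_pow_sub_C,
        fun a b h => ?_⟩
      simp [modPowerSum, ← h]
      ring
    | k + 3, ih =>
      obtain ⟨P, hP, dP, eP⟩ := ih (k + 2) (by omega)
      obtain ⟨P', -, dP', eP'⟩ := ih (k + 1) (by omega)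
      have hd : (X * P).natDegree = k + 3 := by rw [natDegree_X_mul hP.ne_zero, dP]
      have hlt : (C q * P').natDegree < (X * P).natDegree :=
        (natDegree_C_mul_le q P').trans_lt (by omega)
      refine ⟨X * P - C q * P', (monic_X.mul hP).sub_of_left (degree_lt_degree hlt),
        (natDegree_sub_eq_left_of_natDegree_lt hlt).trans hd, fun a b h => ?_⟩
      simp [eP a b h, eP' a b h, modPowerSum, ← h]
      ring

theorem det_modPowerSum {R : Type*} [CommRing R] [Nontrivial R] {n : ℕ} (a b : Fin n → R) {q : R}
    (hab : ∀ i, a i * b i = q) :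
    (Matrix.of fun i j : Fin n => modPowerSum (a i) (b i) j).det =
      (Matrix.vandermonde fun i => a i + b i).det := by
  choose P hP dP eP using fun k : ℕ => exists_monic_eval_eq_modPowerSum q k
  rw [Matrix.det_eval_matrixOfPolynomials_eq_det_vandermonde _ (fun j : Fin n => P j)
    (fun j => dP j) (fun j => hP j)]
  congr 1
  ext i j
  simp [eP j _ _ (hab i)]

theorem hz_of_neg {R : Type*} [CommRing R] {m : ℤ} (hm : m < 0) (l : List R) : hz m l = 0 :=
  if_pos hm

theorem hz_zero {R : Type*} [CommRing R] (l : List R) : hz 0 l = 1 := by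
  simp [hz, hpow]

theorem det_symplecticEntry {R : Type*} [CommRing R] (q : R) (n : ℕ) (l : List R) :
    (Matrix.of fun r k : Fin n => symplecticEntry q n l r k).det = 1 := by
  rw [Matrix.det_of_isUpperTriangular]
  · refine prod_eq_one fun i _ => ?_
    rw [Matrix.of_apply, symplecticEntry, sub_self, hz_zero, hz_of_neg (by omega)]
    simp
  · intro i j hij
    have hij' : (j : ℕ) < i := hij
    rw [Matrix.of_apply, symplecticEntry, hz_of_neg (by omega), hz_of_neg (by omega)]
    simp

/-- Linear combinations of power sums: the determinant is the Vandermonde determinant times the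
determinant of the same combinations of the entries `symplecticEntry`. -/
theorem det_sum_modPowerSum {K : Type*} [Field K] [NeZero (2 : K)] {n : ℕ}
    (a b : Fin n → K) {q : K} (hq : q ≠ 0) (hab : ∀ i, a i * b i = q)
    (s : ℕ → Finset ℕ) (c : ℕ → ℕ → K) :
    (Matrix.of fun i j : Fin n => ∑ k ∈ s j, c j k * modPowerSum (a i) (b i) k).det =
      (Matrix.vandermonde fun i => a i + b i).det *
        (Matrix.of fun r j : Fin n =>
          ∑ k ∈ s j, c j k * symplecticEntry q n (pairList a b) r k).det := by
  obtain ⟨D, hD⟩ := exists_modPowerSum_eq_sum a b hq hab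
  have hdet : D.det = (Matrix.vandermonde fun i => a i + b i).det := by
    rw [← det_modPowerSum a b hab, ← mul_one D.det,
      ← det_symplecticEntry q n (pairList a b), ← Matrix.det_mul]
    congr 1
    ext i j
    rw [Matrix.mul_apply, Matrix.of_apply, hD]
    rfl
  rw [← hdet, ← Matrix.det_mul]
  congr 1
  ext i j
  simp only [Matrix.mul_apply, Matrix.of_apply, hD, mul_sum]
  rw [sum_comm]
  exact sum_congr rfl fun r _ => sum_congr rfl fun k _ => by ring

theorem sq_add_mul_pow {R : Type*} [CommRing R] (x w : R) (j : ℕ) :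
    (x ^ 2 + w * x) ^ j =
      ∑ k ∈ Icc j (2 * j), (Nat.choose j (k - j) : R) * w ^ (2 * j - k) * x ^ k := by
  rw [add_pow]
  refine sum_nbij' (fun m => j + m) (fun k => k - j) ?_ ?_ ?_ ?_ ?_
  · intro m hm
    simp only [mem_range, mem_Icc] at *
    omega
  · intro k hk
    simp only [mem_range, mem_Icc] at *
    omega
  · intro m _
    simp
  · intro k hk
    simp only [mem_Icc] at hk
    omega
  · intro m hm
    rw [mem_range] at hm
    obtain ⟨d, rfl⟩ := Nat.exists_eq_add_of_le (Nat.lt_succ_iff.1 hm)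
    rw [show m + d + m - (m + d) = m by omega, show m + d - m = d by omega,
      show 2 * (m + d) - (m + d + m) = d by omega]
    ring

theorem det_vandermonde_eq_prod_filter {R : Type*} [CommRing R] {n : ℕ} (t : Fin n → R) :
    (Matrix.vandermonde t).det =
      ∏ p ∈ univ.filter (fun p : Fin n × Fin n => p.1 < p.2), (t p.2 - t p.1) := by
  rw [Matrix.det_vandermonde, prod_filter, ← univ_product_univ, prod_product]
  refine prod_congr rfl fun i _ => ?_
  rw [← prod_filter]
  exact prod_congr (by ext; simp) fun _ _ => rfl

/-- The determinant identity over an arbitrary field, for pairs `(a_i, b_i)` with constant nonzero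
product `q`. -/
theorem det_pow_add_pow {K : Type*} [Field K] [NeZero (2 : K)] {m : ℕ}
    (a b : Fin (m + 1) → K) {q : K} (hq : q ≠ 0) (hab : ∀ i, a i * b i = q) (w : K) :
    (Matrix.of fun i j : Fin (m + 1) =>
        (a i ^ 2 + w * a i) ^ (j : ℕ) + (b i ^ 2 + w * b i) ^ (j : ℕ)).det =
      2 * ((Matrix.vandermonde fun i => a i + b i).det *
        (Matrix.of fun i j : Fin m =>
          ∑ k ∈ Icc ((j : ℕ) + 1) (2 * ((j : ℕ) + 1)),
            (Nat.choose ((j : ℕ) + 1) (k - ((j : ℕ) + 1)) : K) *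
              w ^ (2 * ((j : ℕ) + 1) - k) *
              symplecticEntry q (m + 1) (pairList a b) ((i : ℕ) + 1) k).det) := by
  have hcol : (Matrix.of fun i j : Fin (m + 1) =>
      (a i ^ 2 + w * a i) ^ (j : ℕ) + (b i ^ 2 + w * b i) ^ (j : ℕ)) =
      (Matrix.of fun i j : Fin (m + 1) => ∑ k ∈ Icc (j : ℕ) (2 * j),
        (Nat.choose j (k - j) : K) * w ^ (2 * (j : ℕ) - k) * modPowerSum (a i) (b i) k) *
      Matrix.diagonal (Fin.cons 2 fun _ => 1) := by
    ext i j
    rw [Matrix.mul_diagonal, Matrix.of_apply, Matrix.of_apply]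
    refine Fin.cases ?_ (fun j => ?_) j
    · simp [modPowerSum]
      norm_num
    · rw [Fin.cons_succ, mul_one, sq_add_mul_pow, sq_add_mul_pow, ← sum_add_distrib]
      refine sum_congr rfl fun k hk => ?_
      rw [mem_Icc, Fin.val_succ] at hk
      rw [modPowerSum, if_neg (by omega)]
      ring
  rw [hcol, Matrix.det_mul, Matrix.det_diagonal, Fin.prod_univ_succ,
    det_sum_modPowerSum a b hq hab (fun j => Icc j (2 * j))
      (fun j k => (Nat.choose j (k - j) : K) * w ^ (2 * j - k)), mul_comm]
  simp only [Fin.cons_zero, Fin.cons_succ, prod_const_one, mul_one]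
  congr 2
  rw [Matrix.det_succ_column_zero, Fin.sum_univ_succ, sum_eq_zero]
  · have h : symplecticEntry q (m + 1) (pairList a b) 0 0 = 1 := by
      rw [symplecticEntry, Nat.cast_zero, sub_self, hz_zero, hz_of_neg (by omega)]
      simp
    simp [h]
    rfl
  · intro i _
    have h : symplecticEntry q (m + 1) (pairList a b) (i.succ : Fin (m + 1)) 0 = 0 := by
      rw [symplecticEntry, hz_of_neg (by rw [Fin.val_succ]; omega), hz_of_neg (by omega)]
      simp
    rw [Fin.val_succ] at h
    simp [h]

end JacobiTrudi

/-- **Corollary 5.2 (3).** For `n ≥ 1`, in `ℚ(u,v,w,X_1,…,X_n)`, with all `h`'s evaluated at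
`(u X_1, …, u X_n, v X_1^{−1}, …, v X_n^{−1})`:
`(1/2) · det_{1≤i,j≤n}((u²X_i² + uwX_i)^{j−1} + (v²X_i^{−2} + vwX_i^{−1})^{j−1})
  / ∏_{1≤i<j≤n}(X_j − X_i)(u − vX_i^{−1}X_j^{−1})
 = det_{1≤i,j≤n−1}(Σ_{k=j}^{2j} binom(j,k−j) w^{2j−k} (h_{k−i} − u^{n−i}v^{n−i} h_{k+i−2n}))`,
where the empty determinant (case `n = 1`) is `1`. -/
theorem det_add_quotient_eq_jacobiTrudi' (n : ℕ) (hn : 1 ≤ n) :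
    (1 / 2 : Fld n) *
        (Matrix.of fun i j : Fin n =>
          ((uu n) ^ 2 * (XP i) ^ 2 + uu n * wP n * XP i) ^ (j : ℕ) +
            ((vv n) ^ 2 * ((XP i)⁻¹) ^ 2 + vv n * wP n * (XP i)⁻¹) ^ (j : ℕ)).det /
      (∏ p ∈ Finset.univ.filter (fun p : Fin n × Fin n => p.1 < p.2),
          ((XP p.2 - XP p.1) * (uu n - vv n * (XP p.1)⁻¹ * (XP p.2)⁻¹))) =
      (Matrix.of fun i j : Fin (n - 1) =>
        ∑ k ∈ Finset.Icc ((j : ℕ) + 1) (2 * ((j : ℕ) + 1)),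
          (Nat.choose ((j : ℕ) + 1) (k - ((j : ℕ) + 1)) : Fld n) *
            wP n ^ (2 * ((j : ℕ) + 1) - k) *
            (Hn n ((k : ℤ) - ((i : ℕ) + 1)) -
              uu n ^ (n - ((i : ℕ) + 1)) * vv n ^ (n - ((i : ℕ) + 1)) *
                Hn n ((k : ℤ) + ((i : ℕ) + 1) - 2 * (n : ℤ)))).det := by
  obtain ⟨m, rfl⟩ := Nat.exists_eq_add_of_le' hn
  have hX : ∀ s : Fin (m + 1) ⊕ Fin 3, algebraMap (MvPolynomial (Fin (m + 1) ⊕ Fin 3) ℚ)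
      (Fld (m + 1)) (MvPolynomial.X s) ≠ 0 := fun s =>
    (map_ne_zero_iff _ (IsFractionRing.injective _ _)).2 (MvPolynomial.X_ne_zero s)
  have hXi : ∀ i : Fin (m + 1), XP i ≠ 0 := fun i => hX _
  have hab : ∀ i : Fin (m + 1), uu (m + 1) * XP i * (vv (m + 1) * (XP i)⁻¹) =
      uu (m + 1) * vv (m + 1) := fun i => by
    have := hXi i
    field_simp
  have hV : (Matrix.vandermonde fun i : Fin (m + 1) =>
      uu (m + 1) * XP i + vv (m + 1) * (XP i)⁻¹).det =
      ∏ p ∈ Finset.univ.filter (fun p : Fin (m + 1) × Fin (m + 1) => p.1 < p.2),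
        ((XP p.2 - XP p.1) * (uu (m + 1) - vv (m + 1) * (XP p.1)⁻¹ * (XP p.2)⁻¹)) := by
    rw [det_vandermonde_eq_prod_filter]
    refine Finset.prod_congr rfl fun p _ => ?_
    have h1 := hXi p.1
    have h2 := hXi p.2
    field_simp
    ring
  have hV0 : (Matrix.vandermonde fun i : Fin (m + 1) =>
      uu (m + 1) * XP i + vv (m + 1) * (XP i)⁻¹).det ≠ 0 := by
    rw [hV, Finset.prod_ne_zero_iff]
    rintro ⟨i, j⟩ hij
    rw [Finset.mem_filter] at hij
    refine mul_ne_zero (sub_ne_zero.2 fun h => ?_) fun h => ?_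
    · have h1 := MvPolynomial.X_injective (IsFractionRing.injective _ _ h)
      exact hij.2.ne' (Sum.inl_injective h1)
    · have h1 : uu (m + 1) * XP i * XP j = vv (m + 1) := by
        have hi := hXi i
        have hj := hXi j
        field_simp at h
        linear_combination h
      simp only [uu, XP, vv, ← map_mul] at h1
      have h2 := congrArg (MvPolynomial.eval (Sum.elim 0 ![0, 1, 0]))
        (IsFractionRing.injective _ _ h1)
      simp at h2
  have hmain := det_pow_add_pow (fun i : Fin (m + 1) => uu (m + 1) * XP i)
    (fun i => vv (m + 1) * (XP i)⁻¹) (mul_ne_zero (hX _) (hX _)) hab (wP (m + 1))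
  have hL : (Matrix.of fun i j : Fin (m + 1) =>
      ((uu (m + 1)) ^ 2 * (XP i) ^ 2 + uu (m + 1) * wP (m + 1) * XP i) ^ (j : ℕ) +
        ((vv (m + 1)) ^ 2 * ((XP i)⁻¹) ^ 2 + vv (m + 1) * wP (m + 1) * (XP i)⁻¹) ^ (j : ℕ)) =
      Matrix.of fun i j : Fin (m + 1) =>
        ((uu (m + 1) * XP i) ^ 2 + wP (m + 1) * (uu (m + 1) * XP i)) ^ (j : ℕ) +
          ((vv (m + 1) * (XP i)⁻¹) ^ 2 + wP (m + 1) * (vv (m + 1) * (XP i)⁻¹)) ^ (j : ℕ) := by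
    ext i j
    simp only [Matrix.of_apply]
    ring
  rw [hL, hmain, ← hV, div_eq_iff hV0, one_div, inv_mul_cancel_left₀ two_ne_zero, mul_comm]
  simp only [symplecticEntry, mul_pow, Nat.cast_add, Nat.cast_one]
  rfl

end
end

section
/- For every n ≥ 1, the following identity holds in F: det_{1 ≤ i, j ≤ n} ( (u²X_i² + u w X_i)^j − (v²X_i^{−2} + v w X_i^{−1})^j ) = ∏_{i=1}^{n} (u X_i − v X_i^{−1}) · ∏_{1 ≤ i < j ≤ n} (X_j − X_i)(u − v X_i^{−1} X_j^{−1}) · det_{1 ≤ i, j ≤ n} ( Σ_{t=j+1}^{2j} c_{t,j} · h_{t−i}(u X_1 + w + v X_1^{−1}, u X_2 + w + v X_2^{−1}, …, u X_i + w + v X_i^{−1}) ), where c_{t,j} := Σ_{r=0}^{⌊(j−1)/2⌋} (−u v)^r · (−w)^{2j−2r−t} · binom(j − r − 1, r) · binom(j − 2r − 1, t − j − 1) (and the r-th summand is understood to be 0 whenever 2j − 2r − t < 0, which is automatic since then binom(j − 2r − 1, t − j − 1) = 0), and where the (i, j)-entry of the last matrix involves the complete homogeneous symmetric polynomial in the i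 quantities u X_d + w + v X_d^{−1} for d = 1, …, i. -/
noncomputable section

/-- The `i` quantities `(u X_1 + w + v X_1^{−1}, …, u X_i + w + v X_i^{−1})`,
where `i : Fin n` encodes the row index `i + 1`. -/
def rowArgs2 (n : ℕ) (i : Fin n) : List (Fld n) :=
  ((List.finRange n).take ((i : ℕ) + 1)).map fun d => uu n * XP d + wP n + vv n * (XP d)⁻¹

/-- The coefficient
`c_{t,j} = Σ_{r=0}^{⌊(j−1)/2⌋} (−uv)^r (−w)^{2j−2r−t} binom(j−r−1, r) binom(j−2r−1, t−j−1)`,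
where the `r`-th summand vanishes whenever `2j − 2r − t < 0` (automatic, since then
`binom(j − 2r − 1, t − j − 1) = 0`). -/
def ctj (n : ℕ) (t j : ℕ) : Fld n :=
  ∑ r ∈ Finset.range ((j - 1) / 2 + 1),
    (-(uu n * vv n)) ^ r * (-(wP n)) ^ (2 * j - 2 * r - t) *
      (Nat.choose (j - r - 1) r : Fld n) * (Nat.choose (j - 2 * r - 1) (t - j - 1) : Fld n)

section CompleteHomogeneous

variable {R : Type*} [CommRing R]

theorem hpow_succ_cons (m : ℕ) (x : R) (l : List R) :
    hpow (m + 1) (x :: l) = hpow (m + 1) l + x * hpow m (x :: l) := by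
  rw [hpow]

theorem hpow_succ_append_singleton (m : ℕ) (l : List R) (x : R) :
    hpow (m + 1) (l ++ [x]) = hpow (m + 1) l + x * hpow m (l ++ [x]) := by
  induction l generalizing m with
  | nil => simp [hpow]
  | cons a l ihl =>
    induction m with
    | zero => simp [hpow, ihl]; ring
    | succ m ihm =>
      have h₁ := ihl (m + 1)
      rw [List.cons_append] at ihm ⊢
      have h₂ := hpow_succ_cons m a (l ++ [x])
      rw [hpow_succ_cons, hpow_succ_cons (m + 1) a l]
      linear_combination h₁ + a * ihm - x * h₂

theorem hz_append_singleton (m : ℤ) (l : List R) (x : R) :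
    hz m (l ++ [x]) = hz m l + x * hz (m - 1) (l ++ [x]) := by
  rcases lt_trichotomy m 0 with h | h | h
  · simp [hz, h, show m - 1 < 0 by lia]
  · subst h; simp [hz, hpow]
  · obtain ⟨k, rfl⟩ : ∃ k : ℕ, m = k + 1 := ⟨(m - 1).toNat, by lia⟩
    have h₁ : ¬ ((k : ℤ) + 1 < 0) := by lia
    have h₂ : ((k : ℤ) + 1).toNat = k + 1 := by lia
    simp [hz, h₁, h₂, hpow_succ_append_singleton]

theorem hpow_succ_append_pair (m : ℕ) (l : List R) (y x : R) :
    hpow (m + 1) (l ++ [y] ++ [x]) = hpow (m + 1) (l ++ [x]) + y * hpow m (l ++ [y] ++ [x]) := by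
  induction m with
  | zero => simp only [hpow_succ_append_singleton]; simp [hpow]; ring
  | succ m ih =>
    have h := hpow_succ_append_singleton m (l ++ [y]) x
    rw [hpow_succ_append_singleton (m + 1) (l ++ [y]), hpow_succ_append_singleton (m + 1) l,
      hpow_succ_append_singleton (m + 1) l]
    linear_combination x * ih - y * h

theorem hz_append_pair (m : ℤ) (l : List R) (y x : R) :
    hz m (l ++ [y] ++ [x]) = hz m (l ++ [x]) + y * hz (m - 1) (l ++ [y] ++ [x]) := by
  rcases lt_trichotomy m 0 with h | h | h
  · simp [hz, h, show m - 1 < 0 by lia]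
  · subst h; simp [hz, hpow]
  · obtain ⟨k, rfl⟩ : ∃ k : ℕ, m = k + 1 := ⟨(m - 1).toNat, by lia⟩
    have h₁ : ¬ ((k : ℤ) + 1 < 0) := by lia
    have h₂ : ((k : ℤ) + 1).toNat = k + 1 := by lia
    simp only [hz, h₁, h₂, if_false, add_sub_cancel_right, Int.toNat_natCast,
      Int.not_ofNat_neg, hpow_succ_append_pair k l y x]

theorem hpow_singleton (m : ℕ) (x : R) : hpow m [x] = x ^ m := by
  induction m with
  | zero => simp [hpow]
  | succ m ih => rw [hpow, ih, hpow, pow_succ']; ring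

/-- Newton interpolation of the monomial `x ^ m` at the nodes `Y 0, Y 1, …`, with remainder. -/
theorem pow_eq_sum_hz_mul_prod_add (Y : ℕ → R) (x : R) (m K : ℕ) :
    x ^ m = ∑ k ∈ Finset.range K,
        (∏ l ∈ Finset.range k, (x - Y l)) * hz ((m : ℤ) - k) ((List.range (k + 1)).map Y) +
      (∏ l ∈ Finset.range K, (x - Y l)) * hz ((m : ℤ) - K) ((List.range K).map Y ++ [x]) := by
  induction K with
  | zero => simp [hz, hpow_singleton]
  | succ K ih =>
    rw [Finset.sum_range_succ, Finset.prod_range_succ, List.range_succ, List.map_append,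
      List.map_singleton]
    set l := (List.range K).map Y
    have h₁ := hz_append_singleton ((m : ℤ) - K) (l ++ [Y K]) x
    have h₂ := hz_append_pair ((m : ℤ) - K) l (Y K) x
    rw [show ((m : ℤ) - (K + 1 : ℕ)) = (m : ℤ) - K - 1 by push_cast; ring]
    linear_combination ih + (∏ l ∈ Finset.range K, (x - Y l)) * (h₁ - h₂)

theorem pow_eq_sum_hz_mul_prod (Y : ℕ → R) {i n : ℕ} (hi : i < n) (m : ℕ) :
    Y i ^ m = ∑ k ∈ Finset.range n,
      (∏ l ∈ Finset.range k, (Y i - Y l)) * hz ((m : ℤ) - k) ((List.range (k + 1)).map Y) := by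
  rw [pow_eq_sum_hz_mul_prod_add Y (Y i) m n,
    Finset.prod_eq_zero (Finset.mem_range.2 hi) (sub_self _), zero_mul, add_zero]

end CompleteHomogeneous

section PowerDifferences

variable {R : Type*} [CommRing R]

/-- The two-variable Lucas-type polynomials satisfy the recurrence of `a ^ n - b ^ n`. -/
theorem sum_choose_mul_pow_recurrence (p s : R) (j : ℕ) :
    ∑ r ∈ Finset.range (j + 3), (-p) ^ r * ((j + 2 - r).choose r : R) * s ^ (j + 2 - 2 * r) =
      s * ∑ r ∈ Finset.range (j + 2), (-p) ^ r * ((j + 1 - r).choose r : R) * s ^ (j + 1 - 2 * r) -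
      p * ∑ r ∈ Finset.range (j + 1), (-p) ^ r * ((j - r).choose r : R) * s ^ (j - 2 * r) := by
  rw [Finset.sum_range_succ', Finset.sum_range_succ, Finset.sum_range_succ' _ (j + 1),
    mul_add s, Finset.mul_sum, Finset.mul_sum]
  have key : ∀ r ∈ Finset.range (j + 1),
      (-p) ^ (r + 1) * ((j + 2 - (r + 1)).choose (r + 1) : R) * s ^ (j + 2 - 2 * (r + 1)) =
        s * ((-p) ^ (r + 1) * ((j + 1 - (r + 1)).choose (r + 1) : R) *
          s ^ (j + 1 - 2 * (r + 1))) -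
        p * ((-p) ^ r * ((j - r).choose r : R) * s ^ (j - 2 * r)) := by
    intro r hr
    rw [Finset.mem_range] at hr
    rw [show j + 2 - (r + 1) = (j - r) + 1 by lia, show j + 1 - (r + 1) = j - r by lia,
      show j + 2 - 2 * (r + 1) = j - 2 * r by lia, Nat.choose_succ_succ]
    by_cases h : 2 * r < j
    · rw [show j - 2 * r = (j + 1 - 2 * (r + 1)) + 1 by lia]
      push_cast
      ring
    · rw [Nat.choose_eq_zero_of_lt (show j - r < r + 1 by lia)]
      push_cast
      ring
  rw [Finset.sum_congr rfl key, Finset.sum_sub_distrib,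
    Nat.choose_eq_zero_of_lt (show j + 2 - (j + 1 + 1) < j + 1 + 1 by lia)]
  simp
  ring

theorem pow_succ_sub_pow_succ_eq_sum_choose (a b : R) (j : ℕ) :
    a ^ (j + 1) - b ^ (j + 1) = (a - b) * ∑ r ∈ Finset.range (j + 1),
      (-(a * b)) ^ r * ((j - r).choose r : R) * (a + b) ^ (j - 2 * r) := by
  induction j using Nat.twoStepInduction with
  | zero => simp
  | one => simp [Finset.sum_range_succ]; ring
  | more j ih₁ ih₂ =>
    rw [sum_choose_mul_pow_recurrence]
    linear_combination (a + b) * ih₂ - a * b * ih₁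

theorem sum_range_choose_div_two (p s : R) (j : ℕ) :
    ∑ r ∈ Finset.range (j / 2 + 1), (-p) ^ r * ((j - r).choose r : R) * s ^ (j - 2 * r) =
      ∑ r ∈ Finset.range (j + 1), (-p) ^ r * ((j - r).choose r : R) * s ^ (j - 2 * r) := by
  refine Finset.sum_subset (Finset.range_subset_range.2 (by lia)) fun r _ hr => ?_
  rw [Finset.mem_range] at hr
  rw [Nat.choose_eq_zero_of_lt (show j - r < r by lia)]
  simp

theorem sum_Icc_choose_mul_pow (w y : R) (j r : ℕ) :
    ∑ t ∈ Finset.Icc (j + 2) (2 * (j + 1)), (-w) ^ (2 * (j + 1) - 2 * r - t) *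
        ((j - 2 * r).choose (t - (j + 1) - 1) : R) * y ^ (t - 1) =
      y ^ (j + 1) * (y - w) ^ (j - 2 * r) := by
  rw [sub_eq_add_neg, add_pow, Finset.mul_sum, ← Finset.Ico_add_one_right_eq_Icc,
    Finset.sum_Ico_eq_sum_range]
  symm
  refine (Finset.sum_subset (Finset.range_subset_range.2 (by lia)) fun m _ hm => ?_).trans
    (Finset.sum_congr rfl fun m _ => ?_)
  · rw [Finset.mem_range] at hm
    rw [Nat.choose_eq_zero_of_lt (by lia)]
    simp
  · rw [show 2 * (j + 1) - 2 * r - (j + 2 + m) = j - 2 * r - m by lia,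
      show j + 2 + m - (j + 1) - 1 = m by lia, show j + 2 + m - 1 = j + 1 + m by lia, pow_add]
    ring

end PowerDifferences

section Determinants

variable {R : Type*} [CommRing R] {n : ℕ}

theorem prod_filter_lt_eq_prod_prod_range (Y : ℕ → R) :
    ∏ q ∈ Finset.univ.filter (fun q : Fin n × Fin n => q.1 < q.2), (Y q.2 - Y q.1) =
      ∏ i : Fin n, ∏ l ∈ Finset.range i, (Y i - Y l) := by
  rw [Finset.prod_filter, Fintype.prod_prod_type_right]
  refine Finset.prod_congr rfl fun i _ => ?_
  rw [← Finset.prod_filter]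
  refine Finset.prod_bij (fun l _ => (l : ℕ)) ?_ ?_ ?_ ?_
  · intro l hl; exact Finset.mem_range.2 (Finset.mem_filter.1 hl).2
  · intro l _ l' _ h; exact Fin.ext h
  · intro l hl
    rw [Finset.mem_range] at hl
    exact ⟨⟨l, hl.trans i.2⟩, Finset.mem_filter.2 ⟨Finset.mem_univ _, hl⟩, rfl⟩
  · intro l _; rfl

theorem det_newton (Y : ℕ → R) :
    (Matrix.of fun i k : Fin n => ∏ l ∈ Finset.range k, (Y i - Y l)).det =
      ∏ q ∈ Finset.univ.filter (fun q : Fin n × Fin n => q.1 < q.2), (Y q.2 - Y q.1) := by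
  rw [prod_filter_lt_eq_prod_prod_range, Matrix.det_of_isLowerTriangular]
  · rfl
  · intro i k hik
    exact Finset.prod_eq_zero (Finset.mem_range.2 (show (i : ℕ) < k from hik)) (sub_self _)

/-- Replacing powers of the nodes by divided differences extracts a Vandermonde product. -/
theorem det_sum_mul_pow_eq (Y : ℕ → R) (T : ℕ → Finset ℕ) (hT : ∀ j, ∀ t ∈ T j, 1 ≤ t)
    (c : ℕ → ℕ → R) :
    (Matrix.of fun i j : Fin n => ∑ t ∈ T j, c t j * Y i ^ (t - 1)).det =
      (∏ q ∈ Finset.univ.filter (fun q : Fin n × Fin n => q.1 < q.2), (Y q.2 - Y q.1)) *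
      (Matrix.of fun i j : Fin n => ∑ t ∈ T j,
        c t j * hz ((t : ℤ) - ((i : ℕ) + 1)) ((List.range ((i : ℕ) + 1)).map Y)).det := by
  rw [← det_newton, ← Matrix.det_mul]
  congr 1
  ext i j
  simp only [Matrix.mul_apply, Matrix.of_apply, Finset.mul_sum]
  rw [Finset.sum_comm]
  refine Finset.sum_congr rfl fun t ht => ?_
  obtain ⟨m, rfl⟩ : ∃ m, t = m + 1 := ⟨t - 1, by have := hT j t ht; lia⟩
  rw [Nat.add_sub_cancel, pow_eq_sum_hz_mul_prod Y i.2, Finset.mul_sum,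
    ← Fin.sum_univ_eq_sum_range (fun k => c (m + 1) j * ((∏ l ∈ Finset.range k, (Y i - Y l)) *
      hz ((m : ℤ) - k) ((List.range (k + 1)).map Y)))]
  refine Finset.sum_congr rfl fun k _ => ?_
  rw [show (((m + 1 : ℕ) : ℤ) - ((k : ℕ) + 1)) = (m : ℤ) - (k : ℕ) by push_cast; ring]
  ring

/-- Translating both families of nodes by a common constant does not change the determinant of
differences of powers. -/
theorem det_pow_sub_pow_add_const (A B : Fin n → R) (p : R) :
    (Matrix.of fun i j : Fin n => (A i + p) ^ ((j : ℕ) + 1) - (B i + p) ^ ((j : ℕ) + 1)).det =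
      (Matrix.of fun i j : Fin n => A i ^ ((j : ℕ) + 1) - B i ^ ((j : ℕ) + 1)).det := by
  set U : Matrix (Fin n) (Fin n) R :=
    Matrix.of fun k j : Fin n => p ^ ((j : ℕ) - k) * (((j : ℕ) + 1).choose ((k : ℕ) + 1) : R)
    with hU
  have hdet : U.det = 1 := by
    rw [Matrix.det_of_isUpperTriangular]
    · simp [hU]
    · intro k j hkj
      have : (j : ℕ) < k := hkj
      simp [hU, Nat.choose_eq_zero_of_lt (show (j : ℕ) + 1 < k + 1 by lia)]
  rw [← mul_one (Matrix.det (Matrix.of fun i j : Fin n => A i ^ ((j : ℕ) + 1) - _)), ← hdet,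
    ← Matrix.det_mul]
  congr 1
  ext i j
  simp only [Matrix.mul_apply, Matrix.of_apply, hU]
  rw [Fin.sum_univ_eq_sum_range (fun k => (A i ^ (k + 1) - B i ^ (k + 1)) *
      (p ^ ((j : ℕ) - k) * (((j : ℕ) + 1).choose (k + 1) : R))) n,
    ← Finset.sum_subset (Finset.range_subset_range.2 (show (j : ℕ) + 1 ≤ n from j.2)),
    add_pow, add_pow, Finset.sum_range_succ', Finset.sum_range_succ' _ ((j : ℕ) + 1)]
  · simp only [pow_zero, add_sub_add_right_eq_sub, ← Finset.sum_sub_distrib]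
    refine Finset.sum_congr rfl fun k _ => ?_
    rw [show (j : ℕ) + 1 - (k + 1) = j - k by lia]
    ring
  · intro k _ hk
    rw [Finset.mem_range] at hk
    rw [Nat.choose_eq_zero_of_lt (by lia)]
    simp

end Determinants

theorem XP_ne_zero {n : ℕ} (i : Fin n) : (XP i : Fld n) ≠ 0 := by
  rw [XP, Ne, FaithfulSMul.algebraMap_eq_zero_iff]
  exact MvPolynomial.X_ne_zero _

theorem sum_ctj_mul_pow (n j : ℕ) (a b : Fld n) (hab : a * b = uu n * vv n) :
    (a * (a + wP n + b)) ^ (j + 1) - (b * (a + wP n + b)) ^ (j + 1) =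
      (a - b) * ∑ t ∈ Finset.Icc (j + 1 + 1) (2 * (j + 1)),
        ctj n t (j + 1) * (a + wP n + b) ^ (t - 1) := by
  set y := a + wP n + b with hy
  have hs : y - wP n = a + b := by rw [hy]; ring
  have hsum : ∑ t ∈ Finset.Icc (j + 1 + 1) (2 * (j + 1)), ctj n t (j + 1) * y ^ (t - 1) =
      y ^ (j + 1) * ∑ r ∈ Finset.range (j / 2 + 1),
        (-(a * b)) ^ r * ((j - r).choose r : Fld n) * (a + b) ^ (j - 2 * r) := by
    simp only [ctj, Finset.sum_mul]
    rw [Finset.sum_comm, Finset.mul_sum, Nat.add_sub_cancel]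
    refine Finset.sum_congr rfl fun r _ => ?_
    have h := sum_Icc_choose_mul_pow (wP n) y j r
    rw [hs] at h
    rw [mul_left_comm, ← h, Finset.mul_sum, hab]
    refine Finset.sum_congr rfl fun t _ => ?_
    rw [show j + 1 - r - 1 = j - r by lia, show j + 1 - 2 * r - 1 = j - 2 * r by lia]
    ring
  rw [hsum, sum_range_choose_div_two, mul_pow, mul_pow]
  linear_combination y ^ (j + 1) * pow_succ_sub_pow_succ_eq_sum_choose a b j


/-- **Jacobi–Trudi type formula (second version).** For `n ≥ 1`, in `ℚ(u,v,w,X_1,…,X_n)`: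
`det_{1≤i,j≤n}((u²X_i² + uwX_i)^j − (v²X_i^{−2} + vwX_i^{−1})^j)
 = ∏_{i=1}^n (uX_i − vX_i^{−1}) · ∏_{1≤i<j≤n} (X_j − X_i)(u − vX_i^{−1}X_j^{−1})
   · det_{1≤i,j≤n}(Σ_{t=j+1}^{2j} c_{t,j} h_{t−i}(uX_1 + w + vX_1^{−1}, …, uX_i + w + vX_i^{−1}))`. -/
theorem det_bialternant_eq_jacobiTrudi_second (n : ℕ) (hn : 1 ≤ n) :
    (Matrix.of fun i j : Fin n =>
        ((uu n) ^ 2 * (XP i) ^ 2 + uu n * wP n * XP i) ^ ((j : ℕ) + 1) -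
          ((vv n) ^ 2 * ((XP i)⁻¹) ^ 2 + vv n * wP n * (XP i)⁻¹) ^ ((j : ℕ) + 1)).det =
      (∏ i : Fin n, (uu n * XP i - vv n * (XP i)⁻¹)) *
        (∏ p ∈ Finset.univ.filter (fun p : Fin n × Fin n => p.1 < p.2),
          ((XP p.2 - XP p.1) * (uu n - vv n * (XP p.1)⁻¹ * (XP p.2)⁻¹))) *
        (Matrix.of fun i j : Fin n =>
          ∑ t ∈ Finset.Icc (((j : ℕ) + 1) + 1) (2 * ((j : ℕ) + 1)),
            ctj n t ((j : ℕ) + 1) *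
              hz ((t : ℤ) - ((i : ℕ) + 1)) (rowArgs2 n i)).det := by
  set Y : ℕ → Fld n := fun k =>
    if h : k < n then uu n * XP ⟨k, h⟩ + wP n + vv n * (XP ⟨k, h⟩)⁻¹ else 0 with hY
  have hYi : ∀ i : Fin n, Y i = uu n * XP i + wP n + vv n * (XP i)⁻¹ := fun i => by simp [hY]
  have hrow : ∀ i : Fin n, rowArgs2 n i = (List.range ((i : ℕ) + 1)).map Y := by
    intro i
    refine List.ext_getElem (by simp [rowArgs2]) fun k h₁ h₂ => ?_
    have hk : k < n := by simp at h₂; lia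
    simp [rowArgs2, hY, hk]
  have hdiff : ∀ q : Fin n × Fin n,
      (XP q.2 - XP q.1) * (uu n - vv n * (XP q.1)⁻¹ * (XP q.2)⁻¹) = Y q.2 - Y q.1 := by
    intro q
    have h₁ := XP_ne_zero q.1
    have h₂ := XP_ne_zero q.2
    rw [hYi, hYi]
    field_simp
    ring
  simp only [hdiff, hrow]
  rw [mul_assoc, ← det_sum_mul_pow_eq Y (fun j => Finset.Icc (j + 1 + 1) (2 * (j + 1)))
    (fun j t ht => by rw [Finset.mem_Icc] at ht; lia) (fun t j => ctj n t (j + 1)),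
    ← Matrix.det_mul_column, ← det_pow_sub_pow_add_const _ _ (uu n * vv n)]
  congr 1
  ext i j
  have hX := XP_ne_zero i
  have hab : uu n * XP i * (vv n * (XP i)⁻¹) = uu n * vv n := by field_simp
  simp only [Matrix.of_apply, hYi]
  rw [← sum_ctj_mul_pow n j _ _ hab]
  congr 2 <;> linear_combination -hab


end
end
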